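/- Fix ε_n > 0 and ε_s > 0, and let Q(y|x) = e^{-(ε_s x + ε_n)} (ε_s x + ε_n)^y / y! be the transition law of the discrete-time Poisson channel with additive Poisson noise of mean ε_n. Then the normalized divergence D(Q(·|x) ‖ Q(·|0)) / (ε_s x) = -1 + (1 + ε_n/(ε_s x)) log((ε_s x + ε_n)/ε_n) tends to +∞ as x → ∞; consequently sup_{x>0} D(Q(·|x) ‖ Q(·|0)) / (ε_s x) = +∞, i.e. the capacity per unit energy of this channel is infinite and the minimum energy per bit is 0. -/

import Mathlib

open Real Filter

/-- Transition probability of the discrete-time Poisson channel with additive Poisson noise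
of mean `εn`: `Q(y|x) = e^{-(εs x + εn)} (εs x + εn)^y / y!`. -/
noncomputable def QPoisNoise (εs εn x : ℝ) (y : ℕ) : ℝ :=
  Real.exp (-(εs * x + εn)) * (εs * x + εn) ^ y / (y.factorial : ℝ)

/-- Divergence `D(Q(·|x) ‖ Q(·|0))` for the Poisson-noise channel. -/
noncomputable def divPoisNoise (εs εn x : ℝ) : ℝ :=
  ∑' y : ℕ, QPoisNoise εs εn x y *
    Real.log (QPoisNoise εs εn x y / QPoisNoise εs εn 0 y)

theorem hasSum_QPoisNoise (εs εn x : ℝ) : HasSum (QPoisNoise εs εn x) 1 := by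
  have h := (NormedSpace.expSeries_div_hasSum_exp (εs * x + εn)).mul_left
    (Real.exp (-(εs * x + εn)))
  rw [← Real.exp_eq_exp_ℝ, ← Real.exp_add, neg_add_cancel, Real.exp_zero] at h
  exact h.congr_fun fun y => mul_div_assoc _ _ _

theorem succ_mul_QPoisNoise_succ (εs εn x : ℝ) (y : ℕ) :
    ((y + 1 : ℕ) : ℝ) * QPoisNoise εs εn x (y + 1)
      = (εs * x + εn) * QPoisNoise εs εn x y := by
  have h : (y.factorial : ℝ) ≠ 0 := by positivity
  have h' : (y : ℝ) + 1 ≠ 0 := by positivity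
  simp only [QPoisNoise, Nat.factorial_succ, Nat.cast_mul, Nat.cast_add, Nat.cast_one]
  field_simp
  ring

theorem hasSum_natCast_mul_QPoisNoise (εs εn x : ℝ) :
    HasSum (fun y : ℕ => (y : ℝ) * QPoisNoise εs εn x y) (εs * x + εn) := by
  rw [← hasSum_nat_add_iff' 1]
  simpa [-Nat.cast_add, succ_mul_QPoisNoise_succ] using
    (hasSum_QPoisNoise εs εn x).mul_left (εs * x + εn)

theorem log_QPoisNoise_div (εs εn x : ℝ) (hεn : 0 < εn) (hx : 0 < εs * x) (y : ℕ) :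
    Real.log (QPoisNoise εs εn x y / QPoisNoise εs εn 0 y)
      = -(εs * x) + y * Real.log ((εs * x + εn) / εn) := by
  have ha : 0 < εs * x + εn := by positivity
  have h : QPoisNoise εs εn x y / QPoisNoise εs εn 0 y
      = Real.exp (-(εs * x)) * ((εs * x + εn) / εn) ^ y := by
    have hf : (y.factorial : ℝ) ≠ 0 := by positivity
    have he : Real.exp (-(εs * x + εn)) = Real.exp (-(εs * x)) * Real.exp (-εn) := by
      rw [← Real.exp_add]; ring_nf
    have hne := (Real.exp_pos (-εn)).ne'
    simp only [QPoisNoise, mul_zero, zero_add, he, div_pow]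
    generalize Real.exp (-εn) = c at *
    field_simp
  rw [h, Real.log_mul (Real.exp_pos _).ne' (by positivity), Real.log_exp, Real.log_pow]

theorem hasSum_divPoisNoise (εs εn x : ℝ) (hεn : 0 < εn) (hx : 0 < εs * x) :
    HasSum (fun y : ℕ => QPoisNoise εs εn x y *
        Real.log (QPoisNoise εs εn x y / QPoisNoise εs εn 0 y))
      (-(εs * x) + (εs * x + εn) * Real.log ((εs * x + εn) / εn)) := by
  have h := ((hasSum_QPoisNoise εs εn x).mul_right (-(εs * x))).add
    ((hasSum_natCast_mul_QPoisNoise εs εn x).mul_right (Real.log ((εs * x + εn) / εn)))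
  rw [one_mul] at h
  refine h.congr_fun fun y => ?_
  rw [log_QPoisNoise_div εs εn x hεn hx]
  ring

theorem divPoisNoise_div (εs εn x : ℝ) (hεn : 0 < εn) (hx : 0 < εs * x) :
    divPoisNoise εs εn x / (εs * x)
      = -1 + (1 + εn / (εs * x)) * Real.log ((εs * x + εn) / εn) := by
  rw [divPoisNoise, (hasSum_divPoisNoise εs εn x hεn hx).tsum_eq, add_div, neg_div,
    div_self hx.ne', mul_div_right_comm, add_div, div_self hx.ne']

theorem tendsto_normalized_divergence (εs εn : ℝ) (hεn : 0 < εn) (hεs : 0 < εs) :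
    Tendsto (fun x : ℝ => -1 + (1 + εn / (εs * x)) * Real.log ((εs * x + εn) / εn))
      atTop atTop := by
  have hlin : Tendsto (fun x : ℝ => εs * x) atTop atTop := tendsto_id.const_mul_atTop hεs
  have hlog : Tendsto (fun x : ℝ => Real.log ((εs * x + εn) / εn)) atTop atTop :=
    Real.tendsto_log_atTop.comp
      ((tendsto_atTop_add_const_right _ εn hlin).atTop_div_const hεn)
  have hfac : Tendsto (fun x : ℝ => 1 + εn / (εs * x)) atTop (nhds 1) := by
    simpa using (hlin.const_div_atTop εn).const_add 1
  exact tendsto_atTop_add_const_left _ _ (hfac.pos_mul_atTop one_pos hlog)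

/-- For the discrete-time Poisson channel with additive Poisson noise, the normalized
divergence `D(Q(·|x)‖Q(·|0))/(εs x)` equals `-1 + (1 + εn/(εs x)) log((εs x + εn)/εn)`,
which tends to `+∞` as `x → ∞`; consequently the capacity per unit energy
`sup_{x>0} D(Q(·|x)‖Q(·|0))/(εs x)` is infinite. -/
theorem poisson_noise_capacity_per_unit_energy_infinite
    (εn εs : ℝ) (hεn : 0 < εn) (hεs : 0 < εs) :
    (∀ x : ℝ, 0 < x → divPoisNoise εs εn x / (εs * x)
        = -1 + (1 + εn / (εs * x)) * Real.log ((εs * x + εn) / εn)) ∧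
    Tendsto (fun x : ℝ => -1 + (1 + εn / (εs * x)) * Real.log ((εs * x + εn) / εn))
      atTop atTop ∧
    (∀ M : ℝ, ∃ x : ℝ, 0 < x ∧ M < divPoisNoise εs εn x / (εs * x)) := by
  have hdiv : ∀ x : ℝ, 0 < x → divPoisNoise εs εn x / (εs * x)
      = -1 + (1 + εn / (εs * x)) * Real.log ((εs * x + εn) / εn) :=
    fun x hx => divPoisNoise_div εs εn x hεn (mul_pos hεs hx)
  have hlim := tendsto_normalized_divergence εs εn hεn hεs
  refine ⟨hdiv, hlim, fun M => ?_⟩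
  obtain ⟨x, hM, hx⟩ := ((hlim.eventually_gt_atTop M).and (eventually_gt_atTop 0)).exists
  exact ⟨x, hx, by rwa [hdiv x hx]⟩
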